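/- arXiv:2002.04006 — 2 statements merged into one kernel-verified Lean document; each statement's English description precedes it below -/
import Mathlib

section
/- Let k = 2l with integer l ≥ 1, and let 1 > α₁ > … > α_l > 0 and (when l ≥ 2) 1 > a₁ > … > a_{l−1} > 0 be given parameters with associated symmetric configuration. For any integer r ≥ 1, the configuration satisfies the k-r-order orthogonal condition if and only if, for every odd integer i with 1 ≤ i ≤ r, (1 − α₁^{i+1}) + Σ_{j=1}^{l−1} a_j·(α_j^{i+1} − α_{j+1}^{i+1}) = (i+1)/(i+2). -/
open Polynomial

/-- The step interpolation: `(Πw)(x) = w (D m)` for `x ∈ (G m, G (m+1)]`. -/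
noncomputable def stepInterp (k : ℕ) (G D : ℕ → ℝ) (w : ℝ → ℝ) (x : ℝ) : ℝ :=
  ∑ m ∈ Finset.range (k + 1), if x ∈ Set.Ioc (G m) (G (m + 1)) then w (D m) else 0

/-- A symmetric configuration of dual points `G 1 < … < G k` (with `G 0 = -1`,
`G (k+1) = 1`) and interpolation nodes `D 0 = -1 < D 1 < … < D k = 1` on `[-1,1]`. -/
structure SymmConfig (k : ℕ) where
  G : ℕ → ℝ
  D : ℕ → ℝ
  G_zero : G 0 = -1
  G_last : G (k + 1) = 1
  G_mono : ∀ j ≤ k, G j < G (j + 1)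
  G_symm : ∀ j, 1 ≤ j → j ≤ k → G j = -G (k + 1 - j)
  D_zero : D 0 = -1
  D_last : D k = 1
  D_mono : ∀ j < k, D j < D (j + 1)
  D_symm : ∀ j ≤ k, D j = -D (k - j)

/-- The `k`-`r`-order orthogonal condition. -/
def OrthCond (k r : ℕ) (c : SymmConfig k) : Prop :=
  ∀ g w : Polynomial ℝ, g.degree ≤ (r : ℕ) → w.degree ≤ 1 →
    ∫ x in (-1:ℝ)..1,
      g.eval x * (w.eval x - stepInterp k c.G c.D (fun t => w.eval t) x) = 0


open MeasureTheory

theorem integral_mul_ite_Ioc {f : ℝ → ℝ} {p q s t : ℝ} (b : ℝ)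
    (hps : p ≤ s) (hst : s ≤ t) (htq : t ≤ q) :
    ∫ x in p..q, f x * (if x ∈ Set.Ioc s t then b else 0) = b * ∫ x in s..t, f x := by
  have h : ∀ x, f x * (if x ∈ Set.Ioc s t then b else 0)
      = (Set.Ioc s t).indicator (fun x => b * f x) x := by
    intro x
    by_cases hx : x ∈ Set.Ioc s t <;> simp [hx, mul_comm]
  simp_rw [h]
  rw [intervalIntegral.integral_of_le (hps.trans (hst.trans htq)),
    setIntegral_indicator measurableSet_Ioc,
    Set.inter_eq_right.2 (Set.Ioc_subset_Ioc hps htq),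
    intervalIntegral.integral_of_le hst, integral_const_mul]

theorem intervalIntegrable_mul_ite_Ioc {f : ℝ → ℝ} (hf : Continuous f) (p q s t b : ℝ) :
    IntervalIntegrable (fun x => f x * (if x ∈ Set.Ioc s t then b else 0)) volume p q := by
  have h : (fun x => f x * (if x ∈ Set.Ioc s t then b else 0))
      = (Set.Ioc s t).indicator (fun x => f x * b) := by
    funext x
    by_cases hx : x ∈ Set.Ioc s t <;> simp [hx]
  have hi := (hf.mul_const b).intervalIntegrable (μ := volume) p q
  rw [h]
  exact ⟨hi.1.indicator measurableSet_Ioc, hi.2.indicator measurableSet_Ioc⟩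

namespace SymmConfig

variable {k : ℕ} (c : SymmConfig k)

theorem neg_one_le_G {m : ℕ} (hm : m ≤ k + 1) : -1 ≤ c.G m := by
  induction m with
  | zero => exact c.G_zero.ge
  | succ m ih => exact (ih (by omega)).trans (c.G_mono m (by omega)).le

theorem G_le_one {m : ℕ} (hm : m ≤ k + 1) : c.G m ≤ 1 := by
  induction hm using Nat.decreasingInduction with
  | self => exact c.G_last.le
  | of_succ m hm ih => exact (c.G_mono m (by omega)).le.trans ih

theorem G_reflect {m : ℕ} (hm : m ≤ k + 1) : c.G (k + 1 - m) = -c.G m := by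
  rcases Nat.eq_zero_or_pos m with rfl | h0
  · simp [c.G_zero, c.G_last]
  rcases hm.eq_or_lt with rfl | h1
  · simp [c.G_zero, c.G_last]
  · rw [c.G_symm m h0 (by omega), neg_neg]

/-- The integral of `f` times the interpolation error of `w`. -/
theorem integral_mul_sub_stepInterp {f w : ℝ → ℝ} (hf : Continuous f) (hw : Continuous w) :
    ∫ x in (-1:ℝ)..1, f x * (w x - stepInterp k c.G c.D w x)
      = (∫ x in (-1:ℝ)..1, f x * w x)
        - ∑ m ∈ Finset.range (k + 1), w (c.D m) * ∫ x in c.G m..c.G (m + 1), f x := by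
  simp_rw [mul_sub, stepInterp, Finset.mul_sum]
  rw [intervalIntegral.integral_sub (Continuous.intervalIntegrable (by fun_prop) _ _),
    intervalIntegral.integral_finsetSum]
  · congr 1
    refine Finset.sum_congr rfl fun m hm => ?_
    have hm' := Finset.mem_range.1 hm
    exact integral_mul_ite_Ioc _ (c.neg_one_le_G (by omega)) (c.G_mono m (by omega)).le
      (c.G_le_one (by omega))
  · exact fun m _ => intervalIntegrable_mul_ite_Ioc hf _ _ _ _ _
  · have := IntervalIntegrable.sum (μ := volume) (a := (-1 : ℝ)) (b := 1) (Finset.range (k + 1))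
      (f := fun m x => f x * (if x ∈ Set.Ioc (c.G m) (c.G (m + 1)) then w (c.D m) else 0))
      fun m _ => intervalIntegrable_mul_ite_Ioc hf _ _ _ _ _
    simpa only [Finset.sum_fn] using this

theorem sum_integral_G {f : ℝ → ℝ} (hf : Continuous f) :
    ∑ m ∈ Finset.range (k + 1), ∫ x in c.G m..c.G (m + 1), f x = ∫ x in (-1:ℝ)..1, f x := by
  rw [intervalIntegral.sum_integral_adjacent_intervals
    (fun m _ => hf.intervalIntegrable _ _), c.G_zero, c.G_last]

/-- The integral of `x ^ i` times the interpolation error of the identity. -/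
noncomputable def moment (i : ℕ) : ℝ :=
  (∫ x in (-1:ℝ)..1, x ^ i * x)
    - ∑ m ∈ Finset.range (k + 1), c.D m * ∫ x in c.G m..c.G (m + 1), x ^ i

theorem integral_mul_linear (p q : ℝ) {f : ℝ → ℝ} (hf : Continuous f) :
    ∫ x in (-1:ℝ)..1, f x * ((p * x + q) - stepInterp k c.G c.D (fun t => p * t + q) x)
      = p * ((∫ x in (-1:ℝ)..1, f x * x)
        - ∑ m ∈ Finset.range (k + 1), c.D m * ∫ x in c.G m..c.G (m + 1), f x) := by
  rw [c.integral_mul_sub_stepInterp hf (by fun_prop)]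
  have h1 : ∫ x in (-1:ℝ)..1, f x * (p * x + q)
      = p * (∫ x in (-1:ℝ)..1, f x * x) + q * ∫ x in (-1:ℝ)..1, f x := by
    rw [← intervalIntegral.integral_const_mul, ← intervalIntegral.integral_const_mul,
      ← intervalIntegral.integral_add]
    · congr 1
      funext x
      ring
    · exact Continuous.intervalIntegrable (by fun_prop) _ _
    · exact Continuous.intervalIntegrable (by fun_prop) _ _
  rw [h1, ← c.sum_integral_G hf]
  simp_rw [add_mul, Finset.sum_add_distrib, mul_assoc, ← Finset.mul_sum]
  ring

theorem integral_eval_eq_sum_moment {r : ℕ} {g : ℝ[X]} (hg : g.natDegree < r + 1) :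
    (∫ x in (-1:ℝ)..1, g.eval x * x)
        - ∑ m ∈ Finset.range (k + 1), c.D m * ∫ x in c.G m..c.G (m + 1), g.eval x
      = ∑ i ∈ Finset.range (r + 1), g.coeff i * c.moment i := by
  simp_rw [eval_eq_sum_range' hg, Finset.sum_mul, moment, mul_sub, Finset.sum_sub_distrib]
  congr 1
  · rw [intervalIntegral.integral_finsetSum
      fun i _ => Continuous.intervalIntegrable (by fun_prop) _ _]
    simp_rw [mul_assoc, intervalIntegral.integral_const_mul]
  · simp_rw [Finset.mul_sum]
    rw [Finset.sum_comm]
    refine Finset.sum_congr rfl fun m _ => ?_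
    rw [intervalIntegral.integral_finsetSum
      fun i _ => Continuous.intervalIntegrable (by fun_prop) _ _, Finset.mul_sum]
    simp_rw [intervalIntegral.integral_const_mul, mul_left_comm]

theorem orthCond_iff_moment (r : ℕ) : OrthCond k r c ↔ ∀ i ≤ r, c.moment i = 0 := by
  constructor
  · intro h i hi
    have h1 := h (X ^ i) X ((degree_X_pow_le i).trans (by exact_mod_cast hi)) degree_X_le
    have h2 := c.integral_mul_linear 1 0 (f := fun x => x ^ i) (by fun_prop)
    simp only [eval_pow, eval_X] at h1
    simp only [one_mul, add_zero] at h2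
    rw [moment, ← h2, h1]
  · intro h g w hg hw
    have hw' : ∀ x, w.eval x = w.coeff 1 * x + w.coeff 0 := fun x => by
      conv_lhs => rw [eq_X_add_C_of_degree_le_one hw]
      simp
    simp_rw [hw']
    rw [c.integral_mul_linear _ _ g.continuous,
      c.integral_eval_eq_sum_moment (r := r) (Nat.lt_succ_of_le (natDegree_le_of_degree_le hg)),
      Finset.sum_eq_zero, mul_zero]
    intro i hi
    rw [h i (Nat.lt_succ_iff.1 (Finset.mem_range.1 hi)), mul_zero]

/-- The contribution of the `m`-th dual cell to the moment sum. -/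
noncomputable def cellTerm (n m : ℕ) : ℝ := c.D m * (c.G (m + 1) ^ n - c.G m ^ n)

theorem moment_eq (i : ℕ) :
    c.moment i = (1 - (-1) ^ (i + 2)) / ((i : ℝ) + 2)
      - (∑ m ∈ Finset.range (k + 1), c.cellTerm (i + 1) m) / ((i : ℝ) + 1) := by
  simp_rw [moment, ← pow_succ, integral_pow, cellTerm, Finset.sum_div, mul_div_assoc]
  push_cast
  norm_num [add_assoc]

theorem cellTerm_reflect (n : ℕ) {m : ℕ} (hm : m ≤ k) :
    c.cellTerm n (k - m) = (-1) ^ n * c.cellTerm n m := by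
  have h1 : c.G (k - m + 1) = -c.G m := by
    rw [← c.G_reflect (by omega : m ≤ k + 1)]
    congr 1
    omega
  have h2 : c.G (k - m) = -c.G (m + 1) := by
    rw [← c.G_reflect (by omega : m + 1 ≤ k + 1)]
    congr 1
    omega
  rw [cellTerm, cellTerm, h1, h2, c.D_symm m hm, neg_pow (c.G m), neg_pow (c.G (m + 1))]
  ring

theorem sum_cellTerm_odd {n : ℕ} (hn : Odd n) :
    ∑ m ∈ Finset.range (k + 1), c.cellTerm n m = 0 := by
  have h := Finset.sum_range_reflect (c.cellTerm n) (k + 1)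
  rw [Finset.sum_congr rfl (g := fun m => -c.cellTerm n m), Finset.sum_neg_distrib] at h
  · linarith
  · intro m hm
    rw [Nat.add_sub_cancel, c.cellTerm_reflect n (Nat.lt_succ_iff.1 (Finset.mem_range.1 hm)),
      hn.neg_one_pow, neg_one_mul]

theorem sum_cellTerm_even {n l : ℕ} (hn : Even n) (hk : k = 2 * l) (hD : c.D l = 0) :
    ∑ m ∈ Finset.range (k + 1), c.cellTerm n m
      = 2 * ∑ m ∈ Finset.range l, c.cellTerm n m := by
  have h0 : c.cellTerm n l = 0 := by rw [cellTerm, hD, zero_mul]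
  have h1 : ∑ x ∈ Finset.range l, c.cellTerm n (l + 1 + x)
      = ∑ m ∈ Finset.range l, c.cellTerm n m := by
    rw [← Finset.sum_range_reflect (c.cellTerm n) l]
    refine Finset.sum_congr rfl fun x hx => ?_
    have hx' := Finset.mem_range.1 hx
    have h := c.cellTerm_reflect n (m := l - 1 - x) (by omega)
    rw [hn.neg_one_pow, one_mul] at h
    rw [← h]
    congr 1
    omega
  rw [show k + 1 = l + 1 + l by omega, Finset.sum_range_add, Finset.sum_range_succ, h0, h1]
  ring

theorem moment_even {i : ℕ} (hi : Even i) : c.moment i = 0 := by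
  rw [c.moment_eq, c.sum_cellTerm_odd hi.add_one, (hi.add even_two).neg_one_pow]
  simp

theorem moment_odd {i l : ℕ} (hi : Odd i) (hk : k = 2 * l) (hD : c.D l = 0) :
    c.moment i = 0 ↔
      ∑ m ∈ Finset.range l, c.cellTerm (i + 1) m = ((i : ℝ) + 1) / ((i : ℝ) + 2) := by
  rw [c.moment_eq, c.sum_cellTerm_even hi.add_one hk hD, (hi.add_even even_two).neg_one_pow]
  have h1 : (i : ℝ) + 1 ≠ 0 := by positivity
  have h2 : (i : ℝ) + 2 ≠ 0 := by positivity
  rw [sub_eq_zero, div_eq_div_iff h2 h1, eq_div_iff h2]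
  constructor <;> intro h <;> linarith

end SymmConfig

/-- even order `k = 2l`.  The `k`-`r`-order orthogonal condition is
equivalent to the equations (eq:orth_eqs_even1). -/
theorem orthCond_iff_eqs_even (l : ℕ) (hl : 1 ≤ l) (k : ℕ) (hk : k = 2 * l)
    (α a : ℕ → ℝ)
    (hα1 : α 1 < 1) (hαpos : 0 < α l)
    (hαmono : ∀ j, 1 ≤ j → j < l → α (j + 1) < α j)
    (ha1 : 2 ≤ l → a 1 < 1) (hapos : 2 ≤ l → 0 < a (l - 1))
    (hamono : ∀ j, 1 ≤ j → j < l - 1 → a (j + 1) < a j)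
    (c : SymmConfig k)
    (hG : ∀ j, 1 ≤ j → j ≤ l → c.G j = -α j ∧ c.G (k + 1 - j) = α j)
    (hDl : c.D l = 0)
    (hD : ∀ j, 1 ≤ j → j ≤ l - 1 → c.D j = -a j ∧ c.D (k - j) = a j)
    (r : ℕ) (hr : 1 ≤ r) :
    OrthCond k r c ↔
      ∀ i : ℕ, Odd i → 1 ≤ i → i ≤ r →
        (1 - α 1 ^ (i + 1))
          + (∑ j ∈ Finset.Icc 1 (l - 1), a j * (α j ^ (i + 1) - α (j + 1) ^ (i + 1)))
          = ((i : ℝ) + 1) / ((i : ℝ) + 2) := by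
  have hsum : ∀ i : ℕ, Odd i → ∑ m ∈ Finset.range l, c.cellTerm (i + 1) m
      = (1 - α 1 ^ (i + 1))
        + ∑ j ∈ Finset.Icc 1 (l - 1), a j * (α j ^ (i + 1) - α (j + 1) ^ (i + 1)) := by
    intro i hi
    have he : Even (i + 1) := hi.add_one
    rw [Finset.range_eq_Ico, Finset.sum_eq_sum_Ico_succ_bot hl]
    congr 1
    · rw [SymmConfig.cellTerm, c.D_zero, c.G_zero, (hG 1 le_rfl hl).1, he.neg_pow, he.neg_one_pow]
      ring
    · refine Finset.sum_congr (by ext j; simp; omega) fun j hj => ?_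
      have hj' := Finset.mem_Icc.1 hj
      rw [SymmConfig.cellTerm, (hD j hj'.1 hj'.2).1, (hG j hj'.1 (by omega)).1,
        (hG (j + 1) (by omega) (by omega)).1, he.neg_pow, he.neg_pow]
      ring
  rw [c.orthCond_iff_moment]
  constructor
  · intro h i hi _ hir
    rw [← hsum i hi, ← c.moment_odd hi hk hDl]
    exact h i hir
  · intro h i hir
    rcases Nat.even_or_odd i with hi | hi
    · exact c.moment_even hi
    · rw [c.moment_odd hi hk hDl, hsum i hi]
      exact h i hi hi.pos hir
end

section
/- Let k = 2l−1 with integer l ≥ 2, and fix a symmetric configuration on [−1,1] with dual points G₁,…,G_k and interpolation nodes D₀,…,D_k. Suppose real numbers β₂, β₄, …, β_{2(l−1)} and β satisfy the constraints Σ_{t=1}^{l−1} β_{2t}·M̂'_{2t}(G_m) + β·M̂'_{k+1}(G_m) = 0 for every m = 1, …, l−1, and set R := Σ_{t=1}^{l−1} β_{2t}·M̂_{2t} + β·M̂_{k+1}. Then for every real polynomial w of degree at most k, ∫_{−1}^{1} R''(x) · (Π(w − Lw))(x) dx = 0, where Lw is the unique affine function with (Lw)(−1) = w(−1) and (Lw)(1)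 = w(1), and Π(w − Lw) is the step interpolation of w − Lw. -/
open Polynomial

/-- The M-polynomials `M̂ i` on `[-1,1]`:  `M̂ 0 = 1`, `M̂ 1 = ξ`, and
`M̂ (i+1) = (1/(2^i i)) (d/dξ)^(i-1) (ξ² - 1)^i` for `i ≥ 1`. -/
noncomputable def Mhat : ℕ → Polynomial ℝ
  | 0 => 1
  | 1 => Polynomial.X
  | (i + 2) =>
      Polynomial.C (1 / ((2:ℝ) ^ (i + 1) * (i + 1))) *
        ((fun q => Polynomial.derivative q)^[i] ((Polynomial.X ^ 2 - 1) ^ (i + 1)))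

theorem derivative_comp_neg_X {p : ℝ[X]} {ε : ℝ} (hp : p.comp (-X) = C ε * p) :
    (derivative p).comp (-X) = C (-ε) * derivative p := by
  have h := congrArg derivative hp
  rw [derivative_comp, derivative_C_mul] at h
  simp only [derivative_neg, derivative_X] at h
  rw [C_neg, neg_mul, ← h]
  ring

theorem iterate_derivative_comp_neg_X {p : ℝ[X]} (hp : p.comp (-X) = p) (i : ℕ) :
    ((fun q : ℝ[X] => derivative q)^[i] p).comp (-X) =
      C ((-1) ^ i) * (fun q : ℝ[X] => derivative q)^[i] p := by
  induction i with
  | zero => simp [hp]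
  | succ i ih =>
    simp only [Function.iterate_succ', Function.comp_apply]
    rw [derivative_comp_neg_X ih, pow_succ, mul_neg_one]

theorem Mhat_two_mul_comp_neg_X (t : ℕ) : (Mhat (2 * t)).comp (-X) = Mhat (2 * t) := by
  cases t with
  | zero => simp [Mhat]
  | succ t =>
    rw [Nat.mul_succ, Mhat, mul_comp, C_comp,
      iterate_derivative_comp_neg_X (by simp), Even.neg_one_pow (even_two_mul t), C_1, one_mul]

theorem eval_neg_derivative_of_comp_neg_X {p : ℝ[X]} (hp : p.comp (-X) = p) (x : ℝ) :
    (derivative p).eval (-x) = -(derivative p).eval x := by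
  have h := congrArg (eval x) (derivative_comp_neg_X (ε := 1) (by simpa using hp))
  simpa [eval_comp] using h

namespace SymmConfig

variable {k : ℕ} (c : SymmConfig k)

theorem G_le {i j : ℕ} (hij : i ≤ j) (hj : j ≤ k + 1) : c.G i ≤ c.G j := by
  induction j, hij using Nat.le_induction with
  | base => exact le_rfl
  | succ j _ ih => exact (ih (by omega)).trans (c.G_mono j (by omega)).le

/-- An integral against a step interpolant reduces to increments of an antiderivative. -/
theorem integral_derivative_mul_stepInterp (p : ℝ[X]) (v : ℝ → ℝ) :
    ∫ x in (-1:ℝ)..1, (derivative p).eval x * stepInterp k c.G c.D v x =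
      ∑ m ∈ Finset.range (k + 1), v (c.D m) * (p.eval (c.G (m + 1)) - p.eval (c.G m)) := by
  have hterm (m : ℕ) (x : ℝ) : (derivative p).eval x *
      (if x ∈ Set.Ioc (c.G m) (c.G (m + 1)) then v (c.D m) else 0) =
      (Set.Ioc (c.G m) (c.G (m + 1))).indicator
        (fun x => v (c.D m) * (derivative p).eval x) x := by
    rw [Set.indicator_apply]
    split_ifs <;> ring
  have hcont (m : ℕ) : Continuous fun x => v (c.D m) * (derivative p).eval x := by fun_prop
  simp only [stepInterp, Finset.mul_sum, hterm]
  rw [intervalIntegral.integral_of_le (by norm_num), MeasureTheory.integral_finsetSum]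
  · refine Finset.sum_congr rfl fun m hm => ?_
    have hmk : m ≤ k := Nat.lt_succ_iff.mp (Finset.mem_range.mp hm)
    have hsub : Set.Ioc (c.G m) (c.G (m + 1)) ⊆ Set.Ioc (-1) 1 := by
      apply Set.Ioc_subset_Ioc
      · rw [← c.G_zero]
        exact c.G_le (Nat.zero_le m) (by omega)
      · rw [← c.G_last]
        exact c.G_le (by omega) le_rfl
    rw [MeasureTheory.setIntegral_indicator measurableSet_Ioc, Set.inter_eq_right.mpr hsub,
      ← intervalIntegral.integral_of_le (c.G_mono m hmk).le,
      intervalIntegral.integral_const_mul,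
      intervalIntegral.integral_eq_sub_of_hasDerivAt (fun x _ => p.hasDerivAt x)
        ((derivative p).continuous.intervalIntegrable _ _)]
  · intro m _
    exact ((hcont m).integrableOn_Ioc).indicator measurableSet_Ioc

theorem eval_G_eq_zero_of_odd {f : ℝ → ℝ} (hf : ∀ x, f (-x) = -f x)
    (h : ∀ m, 1 ≤ m → 2 * m < k + 1 → f (c.G m) = 0) {m : ℕ} (hm : 1 ≤ m) (hmk : m ≤ k) :
    f (c.G m) = 0 := by
  have hodd : f (c.G m) = -f (c.G (k + 1 - m)) := by rw [c.G_symm m hm hmk, hf]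
  rcases lt_trichotomy (2 * m) (k + 1) with hlt | heq | hgt
  · exact h m hm hlt
  · rw [show k + 1 - m = m by omega] at hodd
    linarith
  · rw [hodd, h _ (by omega) (by omega), neg_zero]

end SymmConfig

/-- under the MMD constraints, `∫_{-1}^{1} R'' · Π(w - Lw) = 0`
for every polynomial `w` of degree at most `k`, where `Lw` is the affine
interpolant of `w` at `±1`. -/
theorem MMD_orthogonal_to_step (l : ℕ) (hl : 2 ≤ l) (k : ℕ) (hk : k = 2 * l - 1)
    (c : SymmConfig k) (β : ℕ → ℝ) (b : ℝ)
    (hconstr : ∀ m, 1 ≤ m → m ≤ l - 1 →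
      (∑ t ∈ Finset.Icc 1 (l - 1),
          β (2 * t) * (Polynomial.derivative (Mhat (2 * t))).eval (c.G m))
        + b * (Polynomial.derivative (Mhat (k + 1))).eval (c.G m) = 0) :
    ∀ w : Polynomial ℝ, w.degree ≤ (k : ℕ) →
      ∫ x in (-1:ℝ)..1,
        (Polynomial.derivative (Polynomial.derivative
            ((∑ t ∈ Finset.Icc 1 (l - 1), Polynomial.C (β (2 * t)) * Mhat (2 * t))
              + Polynomial.C b * Mhat (k + 1)))).eval x *
          stepInterp k c.G c.D
            (fun s => w.eval s -
              ((w.eval 1 + w.eval (-1)) / 2 + (w.eval 1 - w.eval (-1)) / 2 * s)) x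
        = 0 := by
  intro w _
  set R : ℝ[X] := (∑ t ∈ Finset.Icc 1 (l - 1), C (β (2 * t)) * Mhat (2 * t))
    + C b * Mhat (k + 1) with hR
  have hk1 : k + 1 = 2 * l := by omega
  have heven : R.comp (-X) = R := by
    simp only [hR, hk1, add_comp, sum_comp, mul_comp, C_comp, Mhat_two_mul_comp_neg_X]
  have hzero {m : ℕ} (hm : 1 ≤ m) (hmk : m ≤ k) : (derivative R).eval (c.G m) = 0 := by
    refine c.eval_G_eq_zero_of_odd (f := fun x => (derivative R).eval x)
      (eval_neg_derivative_of_comp_neg_X heven) (fun m hm hml => ?_) hm hmk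
    simpa [hR, derivative_sum, eval_finsetSum] using hconstr m hm (by omega)
  rw [c.integral_derivative_mul_stepInterp]
  refine Finset.sum_eq_zero fun m hm => ?_
  have hmk : m ≤ k := Nat.lt_succ_iff.mp (Finset.mem_range.mp hm)
  rcases Nat.eq_zero_or_pos m with rfl | hm0
  · rw [c.D_zero]
    ring
  rcases hmk.eq_or_lt with rfl | hlt
  · rw [c.D_last]
    ring
  · rw [hzero hm0 hmk, hzero (Nat.succ_pos m) hlt, sub_zero, mul_zero]
end
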